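/- Let g(A) be as above and let Π1, Π2 be disjoint subsets of the simple roots Π such that [h_α, g_β] = [h_β, g_α] = 0 for all α ∈ Π1, β ∈ Π2, where h_α = [g_α, g_{−α}]. If θ is a root of g(A) lying in Z_{≥0}Π1 + Z_{≥0}Π2, then θ ∈ Z_{≥0}Π1 or θ ∈ Z_{≥0}Π2. -/

import Mathlib

/-- A complex Lie superalgebra, presented as a module with a ℤ/2-grading
(`even`/`odd` complementary submodules) and a bilinear bracket satisfying
super skew-symmetry and the super Jacobi identity (stated case by case on
homogeneous elements). -/
structure SuperLie (L : Type*) [AddCommGroup L] [Module ℂ L] where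
  even : Submodule ℂ L
  odd : Submodule ℂ L
  bracket : L →ₗ[ℂ] L →ₗ[ℂ] L
  compl : IsCompl even odd
  ee_mem : ∀ x ∈ even, ∀ y ∈ even, bracket x y ∈ even
  eo_mem : ∀ x ∈ even, ∀ y ∈ odd, bracket x y ∈ odd
  oe_mem : ∀ x ∈ odd, ∀ y ∈ even, bracket x y ∈ odd
  oo_mem : ∀ x ∈ odd, ∀ y ∈ odd, bracket x y ∈ even
  skew_e : ∀ x ∈ even, ∀ y : L, bracket x y = - bracket y x
  symm_oo : ∀ x ∈ odd, ∀ y ∈ odd, bracket x y = bracket y x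
  jacobi_e : ∀ x ∈ even, ∀ y z : L,
    bracket x (bracket y z) = bracket (bracket x y) z + bracket y (bracket x z)
  jacobi_oe : ∀ x ∈ odd, ∀ y ∈ even, ∀ z : L,
    bracket x (bracket y z) = bracket (bracket x y) z + bracket y (bracket x z)
  jacobi_oo : ∀ x ∈ odd, ∀ y ∈ odd, ∀ z : L,
    bracket x (bracket y z) = bracket (bracket x y) z - bracket y (bracket x z)

/-- A submodule is an ideal for the bracket `b` if it absorbs brackets on both sides. -/
def IsBracketIdeal {L : Type*} [AddCommGroup L] [Module ℂ L]
    (b : L →ₗ[ℂ] L →ₗ[ℂ] L) (I : Submodule ℂ L) : Prop :=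
  ∀ a : L, ∀ v ∈ I, b a v ∈ I ∧ b v a ∈ I

/-- The subalgebra (smallest bracket-closed submodule) generated by a subspace `P`. -/
def lieSpan {L : Type*} [AddCommGroup L] [Module ℂ L]
    (b : L →ₗ[ℂ] L →ₗ[ℂ] L) (P : Submodule ℂ L) : Submodule ℂ L :=
  sInf {N | P ≤ N ∧ ∀ x ∈ N, ∀ y ∈ N, b x y ∈ N}

/-- `adPow b S T k` is the span of `[S,[S,…,[S,T]…]]` (`k` brackets); used to express
the integrability condition `(ad 𝔤_α)^k 𝔤_β = 0`. -/
def adPow {L : Type*} [AddCommGroup L] [Module ℂ L]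
    (b : L →ₗ[ℂ] L →ₗ[ℂ] L) (S T : Submodule ℂ L) : ℕ → Submodule ℂ L
  | 0 => T
  | k + 1 => Submodule.span ℂ {z | ∃ x ∈ S, ∃ w ∈ adPow b S T k, z = b x w}

/-- A **Cartan datum**, realized inside an ambient Lie superalgebra `L`:
a finite-dimensional quasi-toral subalgebra `𝔥 = hE ⊕ hO`, linearly independent simple
roots `α_1,…,α_n ∈ 𝔱*` (`𝔱 = hE`, each `alpha i` recorded as a functional on `L` whose
restriction to `hE` is the weight), graded `𝔥`-submodules `𝔤_{±α_i} = gp i, gm i` which are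
weight spaces of weight `±α_i`, with `[𝔤_{α_i}, 𝔤_{-α_i}] ⊆ 𝔥`, `[𝔤_{α_i}, 𝔤_{-α_j}] = 0`
for `i ≠ j`, and the pairing `𝔤_{α_i} ⊗ 𝔤_{-α_i} → 𝔥` nondegenerate. -/
structure CartanDatum (L : Type*) [AddCommGroup L] [Module ℂ L] where
  sl : SuperLie L
  hE : Submodule ℂ L
  hO : Submodule ℂ L
  hE_le : hE ≤ sl.even
  hO_le : hO ≤ sl.odd
  hfd : FiniteDimensional ℂ ↥(hE ⊔ hO)
  quasitoral : ∀ t ∈ hE, ∀ z ∈ hE ⊔ hO, sl.bracket t z = 0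
  brOO : ∀ a ∈ hO, ∀ b ∈ hO, sl.bracket a b ∈ hE
  n : ℕ
  alpha : Fin n → (L →ₗ[ℂ] ℂ)
  indep : LinearIndependent ℂ fun i => (alpha i).domRestrict hE
  gp : Fin n → Submodule ℂ L
  gm : Fin n → Submodule ℂ L
  gp_fd : ∀ i, FiniteDimensional ℂ ↥(gp i)
  gm_fd : ∀ i, FiniteDimensional ℂ ↥(gm i)
  gp_graded : ∀ i, gp i = (gp i ⊓ sl.even) ⊔ (gp i ⊓ sl.odd)
  gm_graded : ∀ i, gm i = (gm i ⊓ sl.even) ⊔ (gm i ⊓ sl.odd)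
  gp_wt : ∀ i, ∀ t ∈ hE, ∀ v ∈ gp i, sl.bracket t v = alpha i t • v
  gm_wt : ∀ i, ∀ t ∈ hE, ∀ v ∈ gm i, sl.bracket t v = -(alpha i t) • v
  gp_mod : ∀ i, ∀ t ∈ hE ⊔ hO, ∀ v ∈ gp i, sl.bracket t v ∈ gp i
  gm_mod : ∀ i, ∀ t ∈ hE ⊔ hO, ∀ v ∈ gm i, sl.bracket t v ∈ gm i
  pair_mem : ∀ i, ∀ x ∈ gp i, ∀ y ∈ gm i, sl.bracket x y ∈ hE ⊔ hO
  pair_ne : ∀ i j, i ≠ j → ∀ x ∈ gp i, ∀ y ∈ gm j, sl.bracket x y = 0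
  nondeg_p : ∀ i, ∀ U : Submodule ℂ L, U ≤ gp i → U ≠ ⊥ →
    (∀ t ∈ hE ⊔ hO, ∀ u ∈ U, sl.bracket t u ∈ U) →
    ∃ u ∈ U, ∃ v ∈ gm i, sl.bracket u v ≠ 0
  nondeg_m : ∀ i, ∀ U : Submodule ℂ L, U ≤ gm i → U ≠ ⊥ →
    (∀ t ∈ hE ⊔ hO, ∀ u ∈ U, sl.bracket t u ∈ U) →
    ∃ u ∈ U, ∃ v ∈ gp i, sl.bracket v u ≠ 0

namespace CartanDatum

variable {L : Type*} [AddCommGroup L] [Module ℂ L] (D : CartanDatum L)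

/-- The Cartan subalgebra `𝔥`. -/
def h : Submodule ℂ L := D.hE ⊔ D.hO

/-- The generating subspace `𝒞 = ⊕ᵢ 𝔤_{-α_i} ⊕ 𝔥 ⊕ ⊕ᵢ 𝔤_{α_i}`. -/
def genC : Submodule ℂ L := D.h ⊔ ((⨆ i, D.gp i) ⊔ (⨆ i, D.gm i))

/-- The positive part `𝔫⁺`: the subalgebra generated by the `𝔤_{α_i}`. -/
def Np : Submodule ℂ L := lieSpan D.sl.bracket (⨆ i, D.gp i)

/-- The negative part `𝔫⁻`. -/
def Nm : Submodule ℂ L := lieSpan D.sl.bracket (⨆ i, D.gm i)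

/-- The coroot space `𝔥_{α_i} = [𝔤_{α_i}, 𝔤_{-α_i}]`. -/
def coroot (i : Fin D.n) : Submodule ℂ L :=
  Submodule.span ℂ {z | ∃ x ∈ D.gp i, ∃ y ∈ D.gm i, z = D.sl.bracket x y}

/-- `D.Presented` says the ambient algebra *is* `𝔤̃(𝒜)`: it satisfies the universal
property of the presentation with generators `𝒞` and the defining relations.  Any
linear map to a Lie superalgebra `M` which respects, on `𝒞`, the parity, the bracket of
`𝔥`, the `𝔥`-module structure of the `𝔤_{±α_i}`, the pairings `[𝔤_{α_i}, 𝔤_{-α_i}]`, and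
kills the mixed pairings, extends uniquely to a morphism of Lie superalgebras. -/
def Presented : Prop :=
  ∀ (M : Type*) [AddCommGroup M] [Module ℂ M] (sM : SuperLie M) (f : L →ₗ[ℂ] M),
    (∀ a ∈ D.h, ∀ b ∈ D.h, f (D.sl.bracket a b) = sM.bracket (f a) (f b)) →
    (∀ i, ∀ t ∈ D.h, ∀ v ∈ D.gp i, f (D.sl.bracket t v) = sM.bracket (f t) (f v)) →
    (∀ i, ∀ t ∈ D.h, ∀ v ∈ D.gm i, f (D.sl.bracket t v) = sM.bracket (f t) (f v)) →
    (∀ i, ∀ x ∈ D.gp i, ∀ y ∈ D.gm i, f (D.sl.bracket x y) = sM.bracket (f x) (f y)) →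
    (∀ i j, i ≠ j → ∀ x ∈ D.gp i, ∀ y ∈ D.gm j, sM.bracket (f x) (f y) = 0) →
    (∀ v ∈ D.genC, v ∈ D.sl.even → f v ∈ sM.even) →
    (∀ v ∈ D.genC, v ∈ D.sl.odd → f v ∈ sM.odd) →
    ∃! F : L →ₗ[ℂ] M,
      (∀ a b : L, F (D.sl.bracket a b) = sM.bracket (F a) (F b)) ∧
      (∀ v ∈ D.sl.even, F v ∈ sM.even) ∧ (∀ v ∈ D.sl.odd, F v ∈ sM.odd) ∧
      (∀ v ∈ D.genC, F v = f v)

/-- `D.Reduced` says the ambient algebra *is* `𝔤(𝒜) = 𝔤̃(𝒜)/𝔯`: it has no nonzero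
ideal intersecting `𝔥` trivially. -/
def Reduced : Prop :=
  ∀ I : Submodule ℂ L, IsBracketIdeal D.sl.bracket I → I ⊓ D.h = ⊥ → I = ⊥

/-- The triangular decomposition property `𝔤 = 𝔫⁻ ⊕ 𝔥 ⊕ 𝔫⁺` (as a sum). -/
def Triangular : Prop := D.Nm ⊔ (D.h ⊔ D.Np) = ⊤

end CartanDatum

/-- The weight space of weight `θ` (regarded via its restriction to `𝔱 = hE`). -/
def wtSp {L : Type*} [AddCommGroup L] [Module ℂ L]
    (sl : SuperLie L) (hE : Submodule ℂ L) (θ : L →ₗ[ℂ] ℂ) : Submodule ℂ L :=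
  ⨅ t : ↥hE, LinearMap.ker (sl.bracket t.1 - θ t.1 • (LinearMap.id : L →ₗ[ℂ] L))

section Helpers

variable {L : Type} [AddCommGroup L] [Module ℂ L]

theorem br_span (b : L →ₗ[ℂ] L →ₗ[ℂ] L) (A B : Set L) (N : Submodule ℂ L)
    (hAB : ∀ x ∈ A, ∀ y ∈ B, b x y ∈ N) {x y : L}
    (hx : x ∈ Submodule.span ℂ A) (hy : y ∈ Submodule.span ℂ B) : b x y ∈ N := by
  induction hx using Submodule.span_induction with
  | mem x hx =>
    induction hy using Submodule.span_induction with
    | mem y hy => exact hAB x hx y hy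
    | zero => simp
    | add y z _ _ h1 h2 => rw [map_add]; exact N.add_mem h1 h2
    | smul c y _ h1 => rw [map_smul]; exact N.smul_mem c h1
  | zero => simp
  | add y z _ _ h1 h2 => rw [map_add, LinearMap.add_apply]; exact N.add_mem h1 h2
  | smul c y _ h1 => rw [map_smul, LinearMap.smul_apply]; exact N.smul_mem c h1

def SuperLie.Hom (s : SuperLie L) (x : L) : Prop := x ∈ s.even ∨ x ∈ s.odd

theorem SuperLie.hom_br (s : SuperLie L) {x y : L} (hx : s.Hom x) (hy : s.Hom y) :
    s.Hom (s.bracket x y) := by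
  rcases hx with hx | hx <;> rcases hy with hy | hy
  · exact Or.inl (s.ee_mem x hx y hy)
  · exact Or.inr (s.eo_mem x hx y hy)
  · exact Or.inr (s.oe_mem x hx y hy)
  · exact Or.inl (s.oo_mem x hx y hy)

theorem SuperLie.anti (s : SuperLie L) {x y : L} (hx : s.Hom x) (hy : s.Hom y) :
    ∃ e : ℂ, s.bracket x y = e • s.bracket y x := by
  rcases hx with hx | hx
  · exact ⟨-1, by rw [s.skew_e x hx y]; simp⟩
  · rcases hy with hy | hy
    · exact ⟨-1, by rw [s.skew_e y hy x]; simp⟩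
    · exact ⟨1, by rw [s.symm_oo x hx y hy]; simp⟩

theorem SuperLie.jac (s : SuperLie L) {x y : L} (hx : s.Hom x) (hy : s.Hom y) :
    ∃ e : ℂ, ∀ z, s.bracket x (s.bracket y z) =
      s.bracket (s.bracket x y) z + e • s.bracket y (s.bracket x z) := by
  rcases hx with hx | hx
  · exact ⟨1, fun z => by rw [s.jacobi_e x hx y z]; simp⟩
  · rcases hy with hy | hy
    · exact ⟨1, fun z => by rw [s.jacobi_oe x hx y hy z]; simp⟩
    · exact ⟨-1, fun z => by rw [s.jacobi_oo x hx y hy z]; simp [sub_eq_add_neg]⟩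

theorem SuperLie.jac' (s : SuperLie L) {x y : L} (hx : s.Hom x) (hy : s.Hom y) :
    ∃ e : ℂ, ∀ z, s.bracket (s.bracket x y) z =
      s.bracket x (s.bracket y z) + e • s.bracket y (s.bracket x z) := by
  obtain ⟨e, he⟩ := s.jac hx hy
  exact ⟨-e, fun z => by rw [he z]; simp⟩

/-- homogeneous part span -/
def SuperLie.Gr (s : SuperLie L) (P : Submodule ℂ L) : Prop :=
  P ≤ Submodule.span ℂ {x | x ∈ P ∧ s.Hom x}

theorem SuperLie.gr_of_eq (s : SuperLie L) (P : Submodule ℂ L)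
    (h : P = (P ⊓ s.even) ⊔ (P ⊓ s.odd)) : s.Gr P := by
  intro x hx
  rw [h] at hx
  obtain ⟨y, hy, z, hz, rfl⟩ := Submodule.mem_sup.mp hx
  exact Submodule.add_mem _ (Submodule.subset_span ⟨hy.1, Or.inl hy.2⟩)
    (Submodule.subset_span ⟨hz.1, Or.inr hz.2⟩)

theorem SuperLie.gr_iSup (s : SuperLie L) {ι : Sort*} (P : ι → Submodule ℂ L)
    (h : ∀ i, s.Gr (P i)) : s.Gr (⨆ i, P i) := by
  refine iSup_le fun i => (h i).trans (Submodule.span_mono ?_)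
  rintro x ⟨hx, hx'⟩
  exact ⟨Submodule.mem_iSup_of_mem i hx, hx'⟩

theorem lieSpan_le {b : L →ₗ[ℂ] L →ₗ[ℂ] L} {P N : Submodule ℂ L} (h : P ≤ N)
    (hN : ∀ x ∈ N, ∀ y ∈ N, b x y ∈ N) : lieSpan b P ≤ N :=
  sInf_le ⟨h, hN⟩

theorem le_lieSpan {b : L →ₗ[ℂ] L →ₗ[ℂ] L} {P : Submodule ℂ L} : P ≤ lieSpan b P :=
  le_sInf fun _ h => h.1

theorem lieSpan_br {b : L →ₗ[ℂ] L →ₗ[ℂ] L} {P : Submodule ℂ L} {x y : L}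
    (hx : x ∈ lieSpan b P) (hy : y ∈ lieSpan b P) : b x y ∈ lieSpan b P := by
  simp only [lieSpan, Submodule.mem_sInf] at *
  exact fun N hN => hN.2 x (hx N hN) y (hy N hN)

/-- Span of homogeneous elements mapping `Y` into `N`. -/
theorem SuperLie.stab (s : SuperLie L) (P N : Submodule ℂ L) (hP : s.Gr P)
    (hPN : ∀ x ∈ P, ∀ y ∈ N, s.bracket x y ∈ N) :
    lieSpan s.bracket P ≤ Submodule.span ℂ {x | s.Hom x ∧ ∀ y ∈ N, s.bracket x y ∈ N} := by
  refine lieSpan_le (hP.trans (Submodule.span_mono fun x hx => ⟨hx.2, hPN x hx.1⟩)) ?_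
  intro x hx y hy
  refine br_span _ _ _ _ ?_ hx hy
  rintro x ⟨hx, hx'⟩ y ⟨hy, hy'⟩
  refine Submodule.subset_span ⟨s.hom_br hx hy, fun z hz => ?_⟩
  obtain ⟨e, he⟩ := s.jac' hx hy
  rw [he]
  exact N.add_mem (hx' _ (hy' _ hz)) (N.smul_mem _ (hy' _ (hx' _ hz)))

theorem SuperLie.cent (s : SuperLie L) (P : Submodule ℂ L) (Y : Set L) (hP : s.Gr P)
    (hPN : ∀ x ∈ P, ∀ y ∈ Y, s.bracket x y = 0) :
    lieSpan s.bracket P ≤ Submodule.span ℂ {x | s.Hom x ∧ ∀ y ∈ Y, s.bracket x y = 0} := by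
  refine lieSpan_le (hP.trans (Submodule.span_mono fun x hx => ⟨hx.2, hPN x hx.1⟩)) ?_
  intro x hx y hy
  refine br_span _ _ _ _ ?_ hx hy
  rintro x ⟨hx, hx'⟩ y ⟨hy, hy'⟩
  refine Submodule.subset_span ⟨s.hom_br hx hy, fun z hz => ?_⟩
  obtain ⟨e, he⟩ := s.jac' hx hy
  rw [he, hx' _ hz, hy' _ hz]; simp

theorem SuperLie.comm_lieSpan (s : SuperLie L) (P Q : Submodule ℂ L) (hP : s.Gr P) (hQ : s.Gr Q)
    (h : ∀ x ∈ P, ∀ y ∈ Q, s.bracket x y = 0) :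
    (∀ x ∈ lieSpan s.bracket P, ∀ y ∈ lieSpan s.bracket Q, s.bracket x y = 0) ∧
    (∀ x ∈ lieSpan s.bracket P, ∀ y ∈ lieSpan s.bracket Q, s.bracket y x = 0) := by
  have h1 : ∀ y ∈ Q, ∀ x ∈ lieSpan s.bracket P, s.bracket y x = 0 := by
    intro y hy x hx
    rw [← Submodule.mem_bot ℂ]
    refine br_span _ _ _ _ ?_ (hQ hy) (s.cent P Q hP h hx)
    rintro y ⟨hy, hy'⟩ x ⟨hx, hx'⟩
    obtain ⟨e, he⟩ := s.anti hy' hx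
    rw [he, hx' y hy]; simp
  have h2 := s.cent Q (lieSpan s.bracket P) hQ h1
  have h3 : ∀ x ∈ lieSpan s.bracket P, ∀ y ∈ lieSpan s.bracket Q, s.bracket y x = 0 := by
    intro x hx y hy
    rw [← Submodule.mem_bot ℂ]
    refine br_span _ _ {x} _ ?_ (h2 hy) (Submodule.subset_span rfl)
    rintro y ⟨hy, hy'⟩ _ rfl
    rw [hy' _ hx]; simp
  refine ⟨?_, h3⟩
  -- symmetric direction
  intro x hx y hy
  have hPh := s.cent P (lieSpan s.bracket Q : Set L) hP (by
    intro x hx y hy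
    rw [← Submodule.mem_bot ℂ]
    refine br_span _ _ _ _ ?_ (hP hx) (h2 hy)
    rintro x ⟨hx, hx'⟩ y ⟨hy, hy'⟩
    obtain ⟨e, he⟩ := s.anti hx' hy
    rw [he, hy' x (le_lieSpan hx)]; simp) hx
  rw [← Submodule.mem_bot ℂ]
  refine br_span _ _ {y} _ ?_ hPh (Submodule.subset_span rfl)
  rintro x ⟨_, hx'⟩ _ rfl
  rw [hx' _ hy]; simp

namespace CartanDatum

variable (D : CartanDatum L)

def chi (l : Fin D.n → ℤ) (t : L) : ℂ := ∑ i, (l i : ℂ) * D.alpha i t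

def V (l : Fin D.n → ℤ) : Set L := {v | ∀ t ∈ D.hE, D.sl.bracket t v = D.chi l t • v}

def G (P : Set (Fin D.n → ℤ)) : Submodule ℂ L := Submodule.span ℂ {v | ∃ l ∈ P, v ∈ D.V l}

theorem chi_add (l m : Fin D.n → ℤ) (t : L) : D.chi (l + m) t = D.chi l t + D.chi m t := by
  simp [chi, add_mul, Finset.sum_add_distrib]

theorem V_br {l m : Fin D.n → ℤ} {x y : L} (hx : x ∈ D.V l) (hy : y ∈ D.V m) :
    D.sl.bracket x y ∈ D.V (l + m) := by
  intro t ht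
  rw [D.sl.jacobi_e t (D.hE_le ht), hx t ht, hy t ht, chi_add]
  simp [add_smul]

theorem G_br {P Q R : Set (Fin D.n → ℤ)} (h : ∀ l ∈ P, ∀ m ∈ Q, l + m ∈ R) {x y : L}
    (hx : x ∈ D.G P) (hy : y ∈ D.G Q) : D.sl.bracket x y ∈ D.G R := by
  refine br_span _ _ _ _ ?_ hx hy
  rintro x ⟨l, hl, hx⟩ y ⟨m, hm, hy⟩
  exact Submodule.subset_span ⟨_, h l hl m hm, D.V_br hx hy⟩

theorem G_mono {P Q : Set (Fin D.n → ℤ)} (h : P ⊆ Q) : D.G P ≤ D.G Q :=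
  Submodule.span_mono fun _ ⟨l, hl, hx⟩ => ⟨l, h hl, hx⟩

theorem gp_V (i : Fin D.n) {x : L} (hx : x ∈ D.gp i) : x ∈ D.V (Pi.single i 1) := by
  intro t ht
  rw [D.gp_wt i t ht x hx]
  congr 1
  rw [chi, Finset.sum_eq_single i] <;> simp +contextual [Pi.single_apply]

theorem gm_V (i : Fin D.n) {x : L} (hx : x ∈ D.gm i) : x ∈ D.V (-Pi.single i 1) := by
  intro t ht
  rw [D.gm_wt i t ht x hx]
  congr 1
  rw [chi, Finset.sum_eq_single i] <;> simp +contextual [Pi.single_apply]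

theorem h_V {x : L} (hx : x ∈ D.h) : x ∈ D.V 0 := by
  intro t ht
  rw [D.quasitoral t ht x hx]
  simp [chi]

theorem chi_inj {l m : Fin D.n → ℤ} (h : ∀ t ∈ D.hE, D.chi l t = D.chi m t) : l = m := by
  have := Fintype.linearIndependent_iff.mp D.indep (fun i => (l i : ℂ) - m i) (by
    ext t
    have := h t.1 t.2
    simp only [chi] at this
    simp [sub_mul, Finset.sum_sub_distrib, this])
  funext i
  have := this i
  rw [sub_eq_zero] at this
  exact_mod_cast this

theorem V_disj {k : Fin D.n → ℤ} {P : Set (Fin D.n → ℤ)} (hk : k ∉ P) {v : L}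
    (hv : v ∈ D.V k) (hv' : v ∈ D.G P) : v = 0 := by
  have key := Module.End.independent_iInf_maxGenEigenspace_of_forall_mapsTo
    (fun t : D.hE => (D.sl.bracket t.1 : Module.End ℂ L)) (by
      intro t u c
      apply Module.End.mapsTo_maxGenEigenspace_of_comm
      ext z
      simp only [Module.End.mul_apply]
      rw [D.sl.jacobi_e u.1 (D.hE_le u.2), D.quasitoral u.1 u.2 t.1 (Submodule.mem_sup_left t.2)]
      simp)
  have hle : ∀ l, ∀ x ∈ D.V l, x ∈ ⨅ t : D.hE,
      Module.End.maxGenEigenspace (D.sl.bracket t.1 : Module.End ℂ L) (D.chi l t.1) := by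
    intro l x hx
    rw [Submodule.mem_iInf]
    intro t
    rw [Module.End.mem_maxGenEigenspace]
    refine ⟨1, ?_⟩
    simp [hx t.1 t.2]
  have hd := key (fun t : D.hE => D.chi k t.1)
  refine Submodule.disjoint_def.mp hd v (hle k v hv) ?_
  revert hv'
  apply Submodule.span_le.mpr
  rintro x ⟨l, hl, hx⟩
  have hne : (fun t : D.hE => D.chi l t.1) ≠ (fun t : D.hE => D.chi k t.1) := by
    intro h
    have := D.chi_inj (l := l) (m := k) (fun t ht => congrFun h ⟨t, ht⟩)
    exact hk (this ▸ hl)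
  exact Submodule.mem_iSup_of_mem _ (Submodule.mem_iSup_of_mem hne (hle l x hx))

inductive Mon (a b : Fin D.n) : L → Prop
  | base (x y : L) (hx : x ∈ D.gp a) (hx' : D.sl.Hom x) (hy : y ∈ D.gp b) (hy' : D.sl.Hom y) :
      Mon a b (D.sl.bracket x y)
  | step (i : Fin D.n) (x v : L) (hx : x ∈ D.gp i) (hx' : D.sl.Hom x) (hv : Mon a b v) :
      Mon a b (D.sl.bracket x v)

theorem Mon.hom {a b : Fin D.n} {v : L} (hv : D.Mon a b v) : D.sl.Hom v := by
  induction hv with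
  | base x y hx hx' hy hy' => exact D.sl.hom_br hx' hy'
  | step i x v hx hx' hv ih => exact D.sl.hom_br hx' ih

def MI (a b : Fin D.n) : Submodule ℂ L := Submodule.span ℂ {v | D.Mon a b v}

theorem gp_gr (i : Fin D.n) : D.sl.Gr (D.gp i) := D.sl.gr_of_eq _ (D.gp_graded i)
theorem gm_gr (i : Fin D.n) : D.sl.Gr (D.gm i) := D.sl.gr_of_eq _ (D.gm_graded i)
theorem h_gr : D.sl.Gr D.h := by
  intro x hx
  obtain ⟨y, hy, z, hz, rfl⟩ := Submodule.mem_sup.mp hx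
  exact Submodule.add_mem _
    (Submodule.subset_span ⟨Submodule.mem_sup_left hy, Or.inl (D.hE_le hy)⟩)
    (Submodule.subset_span ⟨Submodule.mem_sup_right hz, Or.inr (D.hO_le hz)⟩)

theorem MI_gp {a b i : Fin D.n} {x v : L} (hx : x ∈ D.gp i) (hv : v ∈ D.MI a b) :
    D.sl.bracket x v ∈ D.MI a b :=
  br_span _ _ _ _ (fun x hx v hv => Submodule.subset_span (Mon.step i x v hx.1 hx.2 hv))
    (D.gp_gr i hx) hv

theorem MI_h {a b : Fin D.n} {x v : L} (hx : x ∈ D.h) (hv : v ∈ D.MI a b) :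
    D.sl.bracket x v ∈ D.MI a b := by
  refine br_span _ _ _ _ ?_ (D.h_gr hx) hv
  rintro t ⟨ht, ht'⟩ v hv
  simp only [Set.mem_ofPred_eq] at hv
  induction hv with
  | base x y hx hx' hy hy' =>
    obtain ⟨e, he⟩ := D.sl.jac ht' hx'
    rw [he]
    refine Submodule.add_mem _ (Submodule.subset_span ?_)
      (Submodule.smul_mem _ _ (Submodule.subset_span ?_))
    · exact Mon.base _ _ (D.gp_mod a t ht x hx) (D.sl.hom_br ht' hx') hy hy'
    · exact Mon.base _ _ hx hx' (D.gp_mod b t ht y hy) (D.sl.hom_br ht' hy')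
  | step i x v hx hx' hv ih =>
    obtain ⟨e, he⟩ := D.sl.jac ht' hx'
    rw [he]
    exact Submodule.add_mem _ (D.MI_gp (D.gp_mod i t ht x hx) (Submodule.subset_span hv))
      (Submodule.smul_mem _ _ (D.MI_gp hx ih))

theorem pair_ne' {i j : Fin D.n} (hij : i ≠ j) {x y : L} (hx : x ∈ D.gp i) (hx' : D.sl.Hom x)
    (hy : y ∈ D.gm j) (hy' : D.sl.Hom y) : D.sl.bracket y x = 0 := by
  obtain ⟨e, he⟩ := D.sl.anti hy' hx'
  rw [he, D.pair_ne i j hij x hx y hy, smul_zero]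

theorem pair_h {i j : Fin D.n} {x y : L} (hx : x ∈ D.gp i) (hx' : D.sl.Hom x)
    (hy : y ∈ D.gm j) (hy' : D.sl.Hom y) : D.sl.bracket y x ∈ D.h := by
  by_cases hij : i = j
  · subst hij
    obtain ⟨e, he⟩ := D.sl.anti hy' hx'
    rw [he]
    exact Submodule.smul_mem _ _ (D.pair_mem i x hx y hy)
  · rw [D.pair_ne' hij hx hx' hy hy']
    exact Submodule.zero_mem _

theorem MI_gm {a b j : Fin D.n} (hab : a ≠ b)
    (h1 : ∀ z ∈ D.coroot a, ∀ v ∈ D.gp b, D.sl.bracket z v = 0)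
    (h2 : ∀ z ∈ D.coroot b, ∀ v ∈ D.gp a, D.sl.bracket z v = 0)
    {x v : L} (hx : x ∈ D.gm j) (hv : v ∈ D.MI a b) :
    D.sl.bracket x v ∈ D.MI a b := by
  have hx2 := D.gm_gr j hx
  clear hx
  refine br_span _ _ _ _ ?_ hx2 hv
  rintro t ⟨ht, ht'⟩ v hv
  simp only [Set.mem_ofPred_eq] at hv
  induction hv with
  | base x y hx hx' hy hy' =>
    obtain ⟨e, he⟩ := D.sl.jac ht' hx'
    have e1 : D.sl.bracket (D.sl.bracket t x) y = 0 := by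
      by_cases haj : a = j
      · subst haj
        obtain ⟨f, hf⟩ := D.sl.anti ht' hx'
        rw [hf, map_smul, LinearMap.smul_apply,
          h1 _ (Submodule.subset_span ⟨x, hx, t, ht, rfl⟩) y hy, smul_zero]
      · rw [D.pair_ne' haj hx hx' ht ht']; simp
    have e2 : D.sl.bracket x (D.sl.bracket t y) = 0 := by
      by_cases hbj : b = j
      · subst hbj
        obtain ⟨f, hf⟩ := D.sl.anti ht' hy'
        obtain ⟨g, hg⟩ := D.sl.anti hx' (D.sl.hom_br hy' ht')
        rw [hf, map_smul, hg, h2 _ (Submodule.subset_span ⟨y, hy, t, ht, rfl⟩) x hx]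
        simp
      · rw [D.pair_ne' hbj hy hy' ht ht']; simp
    rw [he, e1, e2]; simp
  | step i x v hx hx' hv ih =>
    obtain ⟨e, he⟩ := D.sl.jac ht' hx'
    rw [he]
    exact Submodule.add_mem _ (D.MI_h (D.pair_h hx hx' ht ht') (Submodule.subset_span hv))
      (Submodule.smul_mem _ _ (D.MI_gp hx ih))

theorem Mon_wt {a b : Fin D.n} {v : L} (hv : D.Mon a b v) :
    ∃ l : Fin D.n → ℤ, 0 < ∑ i, l i ∧ v ∈ D.V l := by
  induction hv with
  | base x y hx hx' hy hy' =>
    refine ⟨_, ?_, D.V_br (D.gp_V a hx) (D.gp_V b hy)⟩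
    simp [Finset.sum_add_distrib]
  | step i x v hx hx' hv ih =>
    obtain ⟨l, hl, hv⟩ := ih
    refine ⟨_, ?_, D.V_br (D.gp_V i hx) hv⟩
    simp [Finset.sum_add_distrib]
    omega

theorem cross_zero (hred : D.Reduced) (htri : D.Triangular) {a b : Fin D.n} (hab : a ≠ b)
    (h1 : ∀ z ∈ D.coroot a, ∀ v ∈ D.gp b, D.sl.bracket z v = 0)
    (h2 : ∀ z ∈ D.coroot b, ∀ v ∈ D.gp a, D.sl.bracket z v = 0)
    {x y : L} (hx : x ∈ D.gp a) (hy : y ∈ D.gp b) : D.sl.bracket x y = 0 := by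
  have hbot : D.MI a b = ⊥ := by
    apply hred
    · set T := Submodule.span ℂ
        {x | D.sl.Hom x ∧ ∀ y ∈ D.MI a b, D.sl.bracket x y ∈ D.MI a b} with hT
      have hTop : ∀ x, x ∈ T := by
        have : (⊤ : Submodule ℂ L) ≤ T := by
          rw [← htri]
          refine sup_le ?_ (sup_le ?_ ?_)
          · refine D.sl.stab _ _ (D.sl.gr_iSup _ D.gm_gr) ?_
            intro x hx y hy
            refine Submodule.iSup_induction _ (motive := fun x => D.sl.bracket x y ∈ D.MI a b) hx
              (fun i x hx => D.MI_gm hab h1 h2 hx hy) (by simp) ?_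
            intro x z hx hz
            rw [map_add, LinearMap.add_apply]
            exact Submodule.add_mem _ hx hz
          · exact D.h_gr.trans (Submodule.span_mono fun x hx => ⟨hx.2, fun y hy => D.MI_h hx.1 hy⟩)
          · refine D.sl.stab _ _ (D.sl.gr_iSup _ D.gp_gr) ?_
            intro x hx y hy
            refine Submodule.iSup_induction _ (motive := fun x => D.sl.bracket x y ∈ D.MI a b) hx
              (fun i x hx => D.MI_gp hx hy) (by simp) ?_
            intro x z hx hz
            rw [map_add, LinearMap.add_apply]
            exact Submodule.add_mem _ hx hz
        exact fun x => this trivial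
      intro z v hv
      constructor
      · refine br_span _ _ _ _ ?_ (hTop z) hv
        rintro x ⟨_, hx⟩ y hy
        exact hx y (Submodule.subset_span hy)
      · refine br_span _ _ _ _ ?_ hv (hTop z)
        rintro y hy x ⟨hx', hx⟩
        obtain ⟨e, he⟩ := D.sl.anti (Mon.hom D hy) hx'
        rw [he]
        exact Submodule.smul_mem _ _ (hx y (Submodule.subset_span hy))
    · rw [Submodule.eq_bot_iff]
      rintro v ⟨hv, hv'⟩
      refine D.V_disj (k := 0) (P := {l | 0 < ∑ i, l i}) (by simp) (D.h_V hv') ?_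
      exact Submodule.span_mono (fun x hx => D.Mon_wt hx) hv
  rw [← Submodule.mem_bot ℂ, ← hbot]
  exact br_span _ _ _ _ (fun x hx y hy => Submodule.subset_span
    (Mon.base x y hx.1 hx.2 hy.1 hy.2)) (D.gp_gr a hx) (D.gp_gr b hy)

/-- subalgebra generated by the positive simple root spaces in `S` -/
def NS (S : Set (Fin D.n)) : Submodule ℂ L := lieSpan D.sl.bracket (⨆ i : S, D.gp i)

/-- nonnegative weights supported in `S`. -/
def WS (S : Set (Fin D.n)) : Set (Fin D.n → ℤ) := {l | (∀ i, 0 ≤ l i) ∧ ∀ i, l i ≠ 0 → i ∈ S}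

theorem WS_add {S : Set (Fin D.n)} : ∀ l ∈ D.WS S, ∀ m ∈ D.WS S, l + m ∈ D.WS S := by
  intro l hl m hm
  refine ⟨fun i => add_nonneg (hl.1 i) (hm.1 i), fun i hi => ?_⟩
  by_cases h : l i = 0
  · exact hm.2 i (by simpa [h] using hi)
  · exact hl.2 i h

theorem NS_le (S : Set (Fin D.n)) : D.NS S ≤ D.G (D.WS S) := by
  refine lieSpan_le (iSup_le fun i x hx => ?_) fun x hx y hy => D.G_br D.WS_add hx hy
  refine Submodule.subset_span ⟨_, ⟨fun j => ?_, fun j hj => ?_⟩, D.gp_V _ hx⟩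
  · by_cases h : j = i <;> simp [Pi.single_apply, h]
  · by_cases h : j = i
    · rw [h]; exact i.2
    · simp [Pi.single_apply, h] at hj

/-- nonnegative weights not supported in `S`. -/
def WN (S : Set (Fin D.n)) : Set (Fin D.n → ℤ) := {l | (∀ i, 0 ≤ l i) ∧ ∃ i, 0 < l i ∧ i ∉ S}

theorem Np_le (S1 S2 : Set (Fin D.n))
    (hc : ∀ a ∈ S1, ∀ b ∈ S2, ∀ x ∈ D.gp a, ∀ y ∈ D.gp b, D.sl.bracket x y = 0) :
    D.Np ≤ D.NS S1 ⊔ D.NS S2 ⊔ D.G (D.WN (S1 ∪ S2)) := by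
  have hcomm := D.sl.comm_lieSpan (⨆ i : S1, D.gp i) (⨆ i : S2, D.gp i)
    (D.sl.gr_iSup _ fun i => D.gp_gr i) (D.sl.gr_iSup _ fun i => D.gp_gr i) (by
      intro x hx y hy
      refine Submodule.iSup_induction _ (motive := fun x => D.sl.bracket x y = 0) hx ?_ (by simp) ?_
      · intro a x hx
        refine Submodule.iSup_induction _ (motive := fun y => D.sl.bracket x y = 0) hy
          ?_ (by simp) ?_
        · intro b y hy
          exact hc a a.2 b b.2 x hx y hy
        · intro x y hx hy
          simp [hx, hy]
      · intro x y hx hy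
        simp [hx, hy])
  refine lieSpan_le (iSup_le fun i x hx => ?_) ?_
  · by_cases h1 : i ∈ S1
    · refine Submodule.mem_sup_left (Submodule.mem_sup_left (le_lieSpan ?_))
      exact Submodule.mem_iSup_of_mem (⟨i, h1⟩ : S1) hx
    by_cases h2 : i ∈ S2
    · refine Submodule.mem_sup_left (Submodule.mem_sup_right (le_lieSpan ?_))
      exact Submodule.mem_iSup_of_mem (⟨i, h2⟩ : S2) hx
    refine Submodule.mem_sup_right (Submodule.subset_span
      ⟨_, ⟨fun j => ?_, i, by simp, by simp [h1, h2]⟩, D.gp_V _ hx⟩)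
    by_cases h : j = i <;> simp [Pi.single_apply, h]
  · have hnn : D.NS S1 ⊔ D.NS S2 ⊔ D.G (D.WN (S1 ∪ S2)) ≤ D.G {l | ∀ i, 0 ≤ l i} :=
      sup_le (sup_le ((D.NS_le _).trans (D.G_mono fun l hl => hl.1))
        ((D.NS_le _).trans (D.G_mono fun l hl => hl.1))) (D.G_mono fun l hl => hl.1)
    intro x hx y hy
    have hx0 := hnn hx
    have hy0 := hnn hy
    obtain ⟨x', hx', x3, hx3, rfl⟩ := Submodule.mem_sup.mp hx
    obtain ⟨y', hy', y3, hy3, rfl⟩ := Submodule.mem_sup.mp hy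
    have hx'0 := hnn (Submodule.mem_sup_left hx')
    have e1 : D.sl.bracket x3 (y' + y3) ∈ D.G (D.WN (S1 ∪ S2)) :=
      D.G_br (by
        rintro l ⟨hl, i, hi, hi'⟩ m hm
        exact ⟨fun j => add_nonneg (hl j) (hm j), i, add_pos_of_pos_of_nonneg hi (hm i), hi'⟩)
        hx3 hy0
    have e2 : D.sl.bracket x' y3 ∈ D.G (D.WN (S1 ∪ S2)) :=
      D.G_br (by
        rintro m hm l ⟨hl, i, hi, hi'⟩
        exact ⟨fun j => add_nonneg (hm j) (hl j), i, add_pos_of_nonneg_of_pos (hm i) hi, hi'⟩)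
        hx'0 hy3
    have e3 : D.sl.bracket x' y' ∈ D.NS S1 ⊔ D.NS S2 := by
      obtain ⟨x1, hx1, x2, hx2, rfl⟩ := Submodule.mem_sup.mp hx'
      obtain ⟨y1, hy1, y2, hy2, rfl⟩ := Submodule.mem_sup.mp hy'
      have : D.sl.bracket (x1 + x2) (y1 + y2) = D.sl.bracket x1 y1 + D.sl.bracket x2 y2 := by
        simp [hcomm.1 x1 hx1 y2 hy2, hcomm.2 y1 hy1 x2 hx2]
      rw [this]
      exact Submodule.add_mem_sup (lieSpan_br hx1 hy1) (lieSpan_br hx2 hy2)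
    have : D.sl.bracket (x' + x3) (y' + y3) =
        D.sl.bracket x' y' + (D.sl.bracket x' y3 + D.sl.bracket x3 (y' + y3)) := by
      simp only [map_add, LinearMap.add_apply]; abel
    rw [this]
    exact Submodule.add_mem_sup e3 (Submodule.add_mem _ e2 e1)

theorem Nm_le : D.Nm ≤ D.G {l | ∀ i, l i ≤ 0} := by
  refine lieSpan_le (iSup_le fun i x hx => ?_) fun x hx y hy =>
    D.G_br (P := {l | ∀ i, l i ≤ 0}) (Q := {l | ∀ i, l i ≤ 0})
      (R := {l | ∀ i, l i ≤ 0})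
      (fun l hl m hm i => add_nonpos (hl i) (hm i)) hx hy
  refine Submodule.subset_span ⟨_, fun j => ?_, D.gm_V _ hx⟩
  by_cases h : j = i <;> simp [Pi.single_apply, h]

end CartanDatum

end Helpers

/-- Let `Π₁, Π₂` be disjoint sets of simple roots of `𝔤(𝒜)` with
`[𝔥_α, 𝔤_β] = [𝔥_β, 𝔤_α] = 0` for α ∈ Π₁, β ∈ Π₂.  If `θ` is a root of `𝔤(𝒜)` lying in
`ℤ_{≥0}Π₁ + ℤ_{≥0}Π₂`, then `θ ∈ ℤ_{≥0}Π₁` or `θ ∈ ℤ_{≥0}Π₂`. -/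
theorem gA_root_connectivity
    {L : Type} [AddCommGroup L] [Module ℂ L] (D : CartanDatum L)
    (hred : D.Reduced) (htri : D.Triangular)
    (S1 S2 : Set (Fin D.n)) (hdisj : Disjoint S1 S2)
    (hcross : ∀ a ∈ S1, ∀ b ∈ S2,
      (∀ z ∈ D.coroot a, ∀ v ∈ D.gp b, D.sl.bracket z v = 0) ∧
      (∀ z ∈ D.coroot b, ∀ v ∈ D.gp a, D.sl.bracket z v = 0))
    (θ : L →ₗ[ℂ] ℂ)
    (hroot_ne : θ.domRestrict D.hE ≠ 0)
    (hroot : wtSp D.sl D.hE θ ≠ ⊥)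
    (k : Fin D.n → ℕ)
    (hsupp : ∀ i, k i ≠ 0 → i ∈ S1 ∪ S2)
    (hθ : θ.domRestrict D.hE = ∑ i, (k i : ℂ) • (D.alpha i).domRestrict D.hE) :
    (∃ k1 : Fin D.n → ℕ, (∀ i, k1 i ≠ 0 → i ∈ S1) ∧
      θ.domRestrict D.hE = ∑ i, (k1 i : ℂ) • (D.alpha i).domRestrict D.hE) ∨
    (∃ k2 : Fin D.n → ℕ, (∀ i, k2 i ≠ 0 → i ∈ S2) ∧
      θ.domRestrict D.hE = ∑ i, (k2 i : ℂ) • (D.alpha i).domRestrict D.hE) := by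
  have hc : ∀ a ∈ S1, ∀ b ∈ S2, ∀ x ∈ D.gp a, ∀ y ∈ D.gp b, D.sl.bracket x y = 0 :=
    fun a ha b hb x hx y hy => D.cross_zero hred htri
      (fun h => Set.disjoint_left.mp hdisj ha (by rw [h]; exact hb)) (hcross a ha b hb).1 (hcross a ha b hb).2
      hx hy
  by_contra hcon
  push Not at hcon
  obtain ⟨hn1, hn2⟩ := hcon
  apply hroot
  rw [Submodule.eq_bot_iff]
  intro v hv
  have hvV : v ∈ D.V (fun i => (k i : ℤ)) := by
    intro t ht
    have h1 := (Submodule.mem_iInf _).mp hv ⟨t, ht⟩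
    have h2 := LinearMap.congr_fun hθ ⟨t, ht⟩
    simp [sub_eq_zero] at h1 h2
    rw [h1, h2]
    simp [CartanDatum.chi]
  refine D.V_disj (P := {l | ∀ i, l i ≤ 0} ∪ D.WS S1 ∪ D.WS S2 ∪ D.WN (S1 ∪ S2)) ?_ hvV ?_
  · rintro (((h | h) | h) | h)
    · apply hroot_ne
      rw [hθ]
      refine Finset.sum_eq_zero fun i _ => ?_
      have := h i
      have : k i = 0 := by simpa using this
      simp [this]
    · exact hn1 k (fun i hi => h.2 i (Int.natCast_ne_zero.mpr hi)) hθ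
    · exact hn2 k (fun i hi => h.2 i (Int.natCast_ne_zero.mpr hi)) hθ
    · obtain ⟨_, i, hi, hi'⟩ := h
      exact hi' (hsupp i (by
        have : 0 < k i := Int.natCast_pos.mp hi
        omega))
  · have htop : v ∈ D.Nm ⊔ (D.h ⊔ D.Np) := by
      rw [htri]; trivial
    refine (?_ : D.Nm ⊔ (D.h ⊔ D.Np) ≤ _) htop
    apply sup_le
    · exact D.Nm_le.trans (D.G_mono fun l hl => Or.inl (Or.inl (Or.inl hl)))
    apply sup_le
    · intro x hx
      exact Submodule.subset_span ⟨0, Or.inl (Or.inl (Or.inl fun i => le_rfl)), D.h_V hx⟩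
    · refine (D.Np_le S1 S2 hc).trans (sup_le (sup_le ?_ ?_) ?_)
      · exact (D.NS_le S1).trans (D.G_mono fun l hl => Or.inl (Or.inl (Or.inr hl)))
      · exact (D.NS_le S2).trans (D.G_mono fun l hl => Or.inl (Or.inr hl))
      · exact D.G_mono fun l hl => Or.inr hl
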